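/- arXiv:2502.06267 — 2 statements merged into one kernel-verified Lean document; each statement's English description precedes it below -/
import Mathlib

section
/- Maximum-set characterization of the optimizer: α ∈ M(T, η̄) is the minimizer of Φ if and only if for every t in the support Ω(α) of the measure μ_α one has ψ[α](t) = max_{s∈[0,T)} ψ[α](s), where ψ[α](t) = -∫₀ᵗ h[α](s) ds. -/
open MeasureTheory intervalIntegral Real Set Filter Topology

noncomputable def Kker (T δ ηb t r : ℝ) : ℝ :=
  if r < t then (1 - Real.exp (-(ηb + δ) * T))⁻¹ else (Real.exp ((ηb + δ) * T) - 1)⁻¹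

noncomputable def Sfun (T δ ηb : ℝ) (c α : ℝ → ℝ) (t : ℝ) : ℝ :=
  Real.exp (-(α t) - δ * t) * ∫ r in (0:ℝ)..T, Kker T δ ηb t r * c r * Real.exp (α r + δ * r)

noncomputable def Phi (T δ ηb : ℝ) (c w α : ℝ → ℝ) : ℝ :=
  ∫ t in (0:ℝ)..T, w t * Sfun T δ ηb c α t

def MemM (T ηb : ℝ) (α : ℝ → ℝ) : Prop :=
  Monotone α ∧ (∀ t, ContinuousWithinAt α (Set.Ici t) t) ∧ α 0 = 0 ∧
    (∀ t, α (t + T) = α t + α T) ∧ α T = T * ηb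

noncomputable def hfun (T δ ηb : ℝ) (c w α : ℝ → ℝ) (t : ℝ) : ℝ :=
  w t * Real.exp (-(α t) - δ * t) *
      (∫ r in (0:ℝ)..T, Kker T δ ηb t r * c r * Real.exp (α r + δ * r)) -
    c t * Real.exp (α t + δ * t) *
      (∫ r in (0:ℝ)..T, Kker T δ ηb r t * w r * Real.exp (-(α r) - δ * r))

noncomputable def psi (T δ ηb : ℝ) (c w α : ℝ → ℝ) (t : ℝ) : ℝ :=
  - ∫ s in (0:ℝ)..t, hfun T δ ηb c w α s

def SuppM (α : ℝ → ℝ) : Set ℝ := {t | ∀ ε > 0, 0 < α (t + ε) - α (t - ε)}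

def IsOpt (T δ ηb : ℝ) (c w α : ℝ → ℝ) : Prop :=
  MemM T ηb α ∧ ∀ β, MemM T ηb β → Phi T δ ηb c w α ≤ Phi T δ ηb c w β

lemma ii_mul {f g : ℝ → ℝ} {a b : ℝ} (hf : IntervalIntegrable f volume a b)
    (hg : Measurable g) (C : ℝ) (hC : ∀ x ∈ uIcc a b, |g x| ≤ C) :
    IntervalIntegrable (fun x => f x * g x) volume a b := by
  rw [intervalIntegrable_iff] at hf ⊢
  refine Integrable.mul_bdd (c := C) hf hg.aestronglyMeasurable ?_
  refine (ae_restrict_iff' measurableSet_uIoc).2 (ae_of_all _ fun x hx => ?_)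
  exact hC x (uIoc_subset_uIcc hx)

lemma ii_mul_mono {f g : ℝ → ℝ} {a b : ℝ} (hf : IntervalIntegrable f volume a b)
    (hg : Monotone g) :
    IntervalIntegrable (fun x => f x * g x) volume a b := by
  refine ii_mul hf hg.measurable (max |g (min a b)| |g (max a b)|) fun x hx => ?_
  exact abs_le_max_abs_abs (hg hx.1) (hg hx.2)

lemma ii_mul_anti {f g : ℝ → ℝ} {a b : ℝ} (hf : IntervalIntegrable f volume a b)
    (hg : Antitone g) :
    IntervalIntegrable (fun x => f x * g x) volume a b := by
  have := (ii_mul_mono hf hg.neg).neg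
  refine this.congr_ae (ae_of_all _ fun x => ?_)
  simp

lemma ii_per {c : ℝ → ℝ} {T : ℝ} (hT : 0 < T) (hcP : ∀ t, c (t + T) = c t)
    (hcI : IntegrableOn c (Set.Icc 0 T)) (a b : ℝ) : IntervalIntegrable c volume a b := by
  have h : Function.Periodic c T := hcP
  refine h.intervalIntegrable₀ hT.ne' ?_ a b
  rw [intervalIntegrable_iff_integrableOn_Icc_of_le hT.le]
  exact hcI

section
variable {T δ ηb : ℝ}

lemma L_pos (hT : 0 < T) (hδ : 0 < δ) (hη : 0 < ηb) : 0 < (ηb + δ) * T := by positivity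

lemma ab_rel (hT : 0 < T) (hδ : 0 < δ) (hη : 0 < ηb) :
    (1 - Real.exp (-(ηb + δ) * T))⁻¹ = 1 + (Real.exp ((ηb + δ) * T) - 1)⁻¹ ∧
    0 < (Real.exp ((ηb + δ) * T) - 1)⁻¹ ∧
    (Real.exp ((ηb + δ) * T) - 1)⁻¹ * Real.exp ((ηb + δ) * T) =
      1 + (Real.exp ((ηb + δ) * T) - 1)⁻¹ := by
  have hL := L_pos hT hδ hη
  have h1 : 1 < Real.exp ((ηb + δ) * T) := Real.one_lt_exp_iff.2 hL
  have h2 : Real.exp (-(ηb + δ) * T) = (Real.exp ((ηb + δ) * T))⁻¹ := by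
    rw [← Real.exp_neg]; congr 1; ring
  rw [h2]
  set E := Real.exp ((ηb + δ) * T)
  have h3 : E - 1 ≠ 0 := by linarith
  have h4 : E ≠ 0 := by linarith
  have h5 : (1 - E⁻¹) = (E - 1) / E := by field_simp
  refine ⟨?_, by rw [inv_pos]; linarith, ?_⟩
  · rw [h5]; field_simp; ring
  · field_simp; ring

lemma K_eq (hT : 0 < T) (hδ : 0 < δ) (hη : 0 < ηb) (t r : ℝ) :
    Kker T δ ηb t r = (Real.exp ((ηb + δ) * T) - 1)⁻¹ + if r < t then 1 else 0 := by
  unfold Kker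
  rw [(ab_rel hT hδ hη).1]
  split_ifs <;> ring

lemma K_nonneg (hT : 0 < T) (hδ : 0 < δ) (hη : 0 < ηb) (t r : ℝ) :
    0 ≤ Kker T δ ηb t r := by
  rw [K_eq hT hδ hη]
  have := (ab_rel hT hδ hη).2.1
  split_ifs <;> linarith

lemma K_bd (hT : 0 < T) (hδ : 0 < δ) (hη : 0 < ηb) (t r : ℝ) :
    Kker T δ ηb t r ≤ 1 + (Real.exp ((ηb + δ) * T) - 1)⁻¹ := by
  rw [K_eq hT hδ hη]
  split_ifs <;> linarith

lemma K_bd' (hT : 0 < T) (hδ : 0 < δ) (hη : 0 < ηb) (t r : ℝ) :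
    (Real.exp ((ηb + δ) * T) - 1)⁻¹ ≤ Kker T δ ηb t r := by
  rw [K_eq hT hδ hη]
  split_ifs <;> linarith

lemma K_meas : Measurable (fun z : ℝ × ℝ => Kker T δ ηb z.1 z.2) := by
  unfold Kker
  exact Measurable.ite (measurableSet_lt measurable_snd measurable_fst) measurable_const
    measurable_const

lemma K_mono (hT : 0 < T) (hδ : 0 < δ) (hη : 0 < ηb) {t t' : ℝ} (h : t ≤ t') (r : ℝ) :
    Kker T δ ηb t r ≤ Kker T δ ηb t' r := by
  rw [K_eq hT hδ hη, K_eq hT hδ hη]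
  split_ifs <;> linarith

lemma K_anti (hT : 0 < T) (hδ : 0 < δ) (hη : 0 < ηb) {t t' : ℝ} (h : t ≤ t') (r : ℝ) :
    Kker T δ ηb r t' ≤ Kker T δ ηb r t := by
  rw [K_eq hT hδ hη, K_eq hT hδ hη]
  split_ifs <;> linarith

lemma K_ii1 (hT : 0 < T) (hδ : 0 < δ) (hη : 0 < ηb) {p : ℝ → ℝ} {a b : ℝ}
    (hp : IntervalIntegrable p volume a b) (t : ℝ) :
    IntervalIntegrable (fun r => Kker T δ ηb t r * p r) volume a b := by
  have := ii_mul_anti hp (g := fun r => Kker T δ ηb t r) (fun r r' h => K_anti hT hδ hη h t)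
  simpa [mul_comm] using this

lemma K_ii2 (hT : 0 < T) (hδ : 0 < δ) (hη : 0 < ηb) {p : ℝ → ℝ} {a b : ℝ}
    (hp : IntervalIntegrable p volume a b) (t : ℝ) :
    IntervalIntegrable (fun r => Kker T δ ηb r t * p r) volume a b := by
  have := ii_mul_mono hp (g := fun r => Kker T δ ηb r t) (fun r r' h => K_mono hT hδ hη h t)
  simpa [mul_comm] using this

lemma A_mono (hT : 0 < T) (hδ : 0 < δ) (hη : 0 < ηb) {p : ℝ → ℝ} (hp0 : ∀ t, 0 ≤ p t)
    (hp : IntervalIntegrable p volume 0 T) :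
    Monotone (fun t => ∫ r in (0:ℝ)..T, Kker T δ ηb t r * p r) := by
  intro t t' h
  refine intervalIntegral.integral_mono_on hT.le (K_ii1 hT hδ hη hp _) (K_ii1 hT hδ hη hp _) ?_
  intro r _
  exact mul_le_mul_of_nonneg_right (K_mono hT hδ hη h r) (hp0 r)

lemma B_anti (hT : 0 < T) (hδ : 0 < δ) (hη : 0 < ηb) {p : ℝ → ℝ} (hp0 : ∀ t, 0 ≤ p t)
    (hp : IntervalIntegrable p volume 0 T) :
    Antitone (fun t => ∫ r in (0:ℝ)..T, Kker T δ ηb r t * p r) := by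
  intro t t' h
  refine intervalIntegral.integral_mono_on hT.le (K_ii2 hT hδ hη hp _) (K_ii2 hT hδ hη hp _) ?_
  intro r _
  exact mul_le_mul_of_nonneg_right (K_anti hT hδ hη h r) (hp0 r)

lemma fub (hT : 0 < T) (hδ : 0 < δ) (hη : 0 < ηb) {f g : ℝ → ℝ}
    (hf : IntervalIntegrable f volume 0 T) (hg : IntervalIntegrable g volume 0 T) :
    Integrable (fun z : ℝ × ℝ => Kker T δ ηb z.1 z.2 * (f z.1 * g z.2))
      ((volume.restrict (Ioc 0 T)).prod (volume.restrict (Ioc 0 T))) ∧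
    ∫ z, Kker T δ ηb z.1 z.2 * (f z.1 * g z.2)
      ∂((volume.restrict (Ioc 0 T)).prod (volume.restrict (Ioc 0 T))) =
      ∫ t in (0:ℝ)..T, f t * ∫ r in (0:ℝ)..T, Kker T δ ηb t r * g r ∧
    ∫ z, Kker T δ ηb z.1 z.2 * (f z.1 * g z.2)
      ∂((volume.restrict (Ioc 0 T)).prod (volume.restrict (Ioc 0 T))) =
      ∫ t in (0:ℝ)..T, g t * ∫ r in (0:ℝ)..T, Kker T δ ηb r t * f r := by
  rw [intervalIntegrable_iff_integrableOn_Ioc_of_le hT.le] at hf hg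
  have hI : Integrable (fun z : ℝ × ℝ => Kker T δ ηb z.1 z.2 * (f z.1 * g z.2))
      ((volume.restrict (Ioc 0 T)).prod (volume.restrict (Ioc 0 T))) := by
    refine Integrable.bdd_mul (c := 1 + (Real.exp ((ηb + δ) * T) - 1)⁻¹)
      (Integrable.mul_prod hf hg) K_meas.aestronglyMeasurable (ae_of_all _ fun z => ?_)
    rw [Real.norm_of_nonneg (K_nonneg hT hδ hη _ _)]
    exact K_bd hT hδ hη _ _
  refine ⟨hI, ?_, ?_⟩
  · rw [integral_prod _ hI]
    simp_rw [intervalIntegral.integral_of_le hT.le]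
    refine integral_congr_ae (ae_of_all _ fun t => ?_)
    simp only
    rw [← MeasureTheory.integral_const_mul]
    refine integral_congr_ae (ae_of_all _ fun r => ?_)
    simp only; ring
  · rw [integral_prod_symm _ hI]
    simp_rw [intervalIntegral.integral_of_le hT.le]
    refine integral_congr_ae (ae_of_all _ fun t => ?_)
    simp only
    rw [← MeasureTheory.integral_const_mul]
    refine integral_congr_ae (ae_of_all _ fun r => ?_)
    simp only; ring

/-- Stieltjes function of a member of the class. -/
noncomputable def stj {α : ℝ → ℝ} (h : MemM T ηb α) : StieltjesFunction ℝ :=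
  ⟨α, h.1, h.2.1⟩

lemma stj_Ioc {α : ℝ → ℝ} (h : MemM T ηb α) (a b : ℝ) :
    (stj h).measure (Ioc a b) = ENNReal.ofReal (α b - α a) := by
  rw [StieltjesFunction.measure_Ioc]; rfl

lemma stj_fub {α h : ℝ → ℝ} (hT : 0 < T) (hα : MemM T ηb α)
    (hh : IntervalIntegrable h volume 0 T) :
    ∫ t in (0:ℝ)..T, h t * α t = ∫ s in Ioc 0 T, (∫ t in s..T, h t) ∂(stj hα).measure := by
  have hh' := hh
  rw [intervalIntegrable_iff_integrableOn_Ioc_of_le hT.le] at hh'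
  set μ := (stj hα).measure.restrict (Ioc 0 T) with hμ
  have : IsFiniteMeasure μ := by
    refine ⟨?_⟩
    rw [hμ, Measure.restrict_apply_univ, stj_Ioc]
    exact ENNReal.ofReal_lt_top
  have hms : MeasurableSet {z : ℝ × ℝ | z.2 ≤ z.1} := measurableSet_le measurable_snd measurable_fst
  have hI : Integrable (Function.uncurry fun t s : ℝ => if s ≤ t then h t else 0)
      ((volume.restrict (Ioc 0 T)).prod μ) := by
    have h1 : Integrable (fun z : ℝ × ℝ => h z.1 * (1:ℝ)) ((volume.restrict (Ioc 0 T)).prod μ) :=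
      Integrable.mul_prod (f := h) (g := fun _ => (1:ℝ)) hh' (integrable_const 1)
    have h2 := h1.indicator hms
    refine h2.congr (ae_of_all _ fun z => ?_)
    simp [Set.indicator, Function.uncurry]
  have key := integral_integral_swap hI
  rw [intervalIntegral.integral_of_le hT.le]
  have e1 : ∫ t in Ioc 0 T, h t * α t = ∫ t in Ioc 0 T, ∫ s, (if s ≤ t then h t else 0) ∂μ := by
    refine setIntegral_congr_fun measurableSet_Ioc fun t ht => ?_
    have : (fun s => if s ≤ t then h t else 0) = (Iic t).indicator (fun _ => h t) := by
      ext s; simp [Set.indicator]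
    simp only [this]
    rw [MeasureTheory.integral_indicator measurableSet_Iic, setIntegral_const, hμ, Measure.real,
      Measure.restrict_apply measurableSet_Iic]
    have : Iic t ∩ Ioc 0 T = Ioc 0 t := by
      ext s; simp only [mem_inter_iff, mem_Iic, mem_Ioc]
      exact ⟨fun h => ⟨h.2.1, h.1⟩, fun h => ⟨h.2, h.1, h.2.trans ht.2⟩⟩
    rw [this, stj_Ioc, hα.2.2.1, sub_zero, ENNReal.toReal_ofReal, smul_eq_mul, mul_comm]
    rw [← hα.2.2.1]; exact hα.1 ht.1.le
  rw [e1, key]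
  refine setIntegral_congr_fun measurableSet_Ioc fun s hs => ?_
  have : (fun t => if s ≤ t then h t else 0) = (Ici s).indicator h := by
    ext t; simp [Set.indicator]
  simp only [this]
  rw [MeasureTheory.integral_indicator measurableSet_Ici, Measure.restrict_restrict measurableSet_Ici,
    intervalIntegral.integral_of_le hs.2]
  have : Ici s ∩ Ioc 0 T = Icc s T := by
    ext t; simp only [mem_inter_iff, mem_Ici, mem_Icc, mem_Ioc]
    exact ⟨fun h => ⟨h.1, h.2.2⟩, fun h => ⟨h.1, hs.1.trans_le h.1, h.2⟩⟩
  rw [this, integral_Icc_eq_integral_Ioc]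

end

section
variable {T δ ηb : ℝ} {c w : ℝ → ℝ}

structure Hyp (T δ ηb : ℝ) (c w : ℝ → ℝ) : Prop where
  hT : 0 < T
  hδ : 0 < δ
  hη : 0 < ηb
  hc0 : ∀ t, 0 ≤ c t
  hcP : ∀ t, c (t + T) = c t
  hcI : IntegrableOn c (Set.Icc 0 T)
  hw0 : ∀ t, 0 ≤ w t
  hwP : ∀ t, w (t + T) = w t
  hwI : IntegrableOn w (Set.Icc 0 T)

noncomputable def pf (δ : ℝ) (c α : ℝ → ℝ) (t : ℝ) : ℝ := c t * Real.exp (α t + δ * t)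
noncomputable def qf (δ : ℝ) (w α : ℝ → ℝ) (t : ℝ) : ℝ := w t * Real.exp (-(α t) - δ * t)

lemma pf_nonneg (H : Hyp T δ ηb c w) (α : ℝ → ℝ) (t : ℝ) : 0 ≤ pf δ c α t :=
  mul_nonneg (H.hc0 t) (Real.exp_nonneg _)
lemma qf_nonneg (H : Hyp T δ ηb c w) (α : ℝ → ℝ) (t : ℝ) : 0 ≤ qf δ w α t :=
  mul_nonneg (H.hw0 t) (Real.exp_nonneg _)

lemma pf_ii (H : Hyp T δ ηb c w) {α : ℝ → ℝ} (hα : MemM T ηb α) (a b : ℝ) :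
    IntervalIntegrable (pf δ c α) volume a b := by
  refine ii_mul_mono (ii_per H.hT H.hcP H.hcI a b) (g := fun t => Real.exp (α t + δ * t)) ?_
  intro x y h
  have := hα.1 h
  have := mul_le_mul_of_nonneg_left h H.hδ.le
  exact Real.exp_le_exp.2 (by linarith)

lemma qf_ii (H : Hyp T δ ηb c w) {α : ℝ → ℝ} (hα : MemM T ηb α) (a b : ℝ) :
    IntervalIntegrable (qf δ w α) volume a b := by
  refine ii_mul_anti (ii_per H.hT H.hwP H.hwI a b) (g := fun t => Real.exp (-(α t) - δ * t)) ?_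
  intro x y h
  have := hα.1 h
  have := mul_le_mul_of_nonneg_left h H.hδ.le
  exact Real.exp_le_exp.2 (by linarith)

lemma hfun_eq (α : ℝ → ℝ) (t : ℝ) : hfun T δ ηb c w α t =
    qf δ w α t * (∫ r in (0:ℝ)..T, Kker T δ ηb t r * pf δ c α r) -
    pf δ c α t * (∫ r in (0:ℝ)..T, Kker T δ ηb r t * qf δ w α r) := by
  simp only [hfun, pf, qf, mul_assoc]

lemma Phi_eq (α : ℝ → ℝ) : Phi T δ ηb c w α =
    ∫ t in (0:ℝ)..T, qf δ w α t * (∫ r in (0:ℝ)..T, Kker T δ ηb t r * pf δ c α r) := by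
  simp only [Phi, Sfun, pf, qf, mul_assoc]

lemma h_ii (H : Hyp T δ ηb c w) {α : ℝ → ℝ} (hα : MemM T ηb α) (a b : ℝ) :
    IntervalIntegrable (hfun T δ ηb c w α) volume a b := by
  have e : hfun T δ ηb c w α = fun t =>
    qf δ w α t * (∫ r in (0:ℝ)..T, Kker T δ ηb t r * pf δ c α r) -
    pf δ c α t * (∫ r in (0:ℝ)..T, Kker T δ ηb r t * qf δ w α r) := funext (hfun_eq α)
  rw [e]
  exact (ii_mul_mono (qf_ii H hα a b)
      (A_mono H.hT H.hδ H.hη (pf_nonneg H α) (pf_ii H hα 0 T))).sub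
    (ii_mul_anti (pf_ii H hα a b)
      (B_anti H.hT H.hδ H.hη (qf_nonneg H α) (qf_ii H hα 0 T)))

lemma h_zero (H : Hyp T δ ηb c w) {α : ℝ → ℝ} (hα : MemM T ηb α) :
    ∫ t in (0:ℝ)..T, hfun T δ ηb c w α t = 0 := by
  simp only [hfun_eq]
  rw [intervalIntegral.integral_sub]
  · obtain ⟨_, h1, h2⟩ := fub H.hT H.hδ H.hη (qf_ii H hα 0 T) (pf_ii H hα 0 T)
    rw [← h1, ← h2, sub_self]
  · exact (ii_mul_mono (qf_ii H hα 0 T)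
      (A_mono H.hT H.hδ H.hη (pf_nonneg H α) (pf_ii H hα 0 T)))
  · exact (ii_mul_anti (pf_ii H hα 0 T)
      (B_anti H.hT H.hδ H.hη (qf_nonneg H α) (qf_ii H hα 0 T)))

lemma h_step (H : Hyp T δ ηb c w) {α : ℝ → ℝ} (hα : MemM T ηb α) (t : ℝ) :
    hfun T δ ηb c w α (t + T) ≤ hfun T δ ηb c w α t := by
  obtain ⟨h1, h2, h3⟩ := ab_rel H.hT H.hδ H.hη
  set b := (Real.exp ((ηb + δ) * T) - 1)⁻¹ with hb
  set E := Real.exp ((ηb + δ) * T) with hE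
  have hE0 : 0 < E := Real.exp_pos _
  have ep : pf δ c α (t + T) = pf δ c α t * E := by
    rw [pf, pf, H.hcP, hα.2.2.2.1, hα.2.2.2.2, mul_assoc, hE, ← Real.exp_add]
    congr 2; ring
  have eq : qf δ w α (t + T) * E = qf δ w α t := by
    rw [qf, qf, H.hwP, hα.2.2.2.1, hα.2.2.2.2, mul_assoc, hE, ← Real.exp_add]
    congr 2; ring
  have hp := pf_ii H hα 0 T
  have hq := qf_ii H hα 0 T
  have hA : (∫ r in (0:ℝ)..T, Kker T δ ηb (t + T) r * pf δ c α r) ≤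
      E * (∫ r in (0:ℝ)..T, Kker T δ ηb t r * pf δ c α r) := by
    rw [← intervalIntegral.integral_const_mul]
    refine intervalIntegral.integral_mono_on H.hT.le (K_ii1 H.hT H.hδ H.hη hp _)
      ((K_ii1 H.hT H.hδ H.hη hp _).const_mul _) fun r _ => ?_
    rw [← mul_assoc]
    refine mul_le_mul_of_nonneg_right ?_ (pf_nonneg H α r)
    have k1 := K_bd H.hT H.hδ H.hη (t + T) r
    have k2 := K_bd' H.hT H.hδ H.hη t r
    rw [← hb] at k1 k2
    nlinarith
  have hB : (∫ r in (0:ℝ)..T, Kker T δ ηb r t * qf δ w α r) ≤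
      E * (∫ r in (0:ℝ)..T, Kker T δ ηb r (t + T) * qf δ w α r) := by
    rw [← intervalIntegral.integral_const_mul]
    refine intervalIntegral.integral_mono_on H.hT.le (K_ii2 H.hT H.hδ H.hη hq _)
      ((K_ii2 H.hT H.hδ H.hη hq _).const_mul _) fun r _ => ?_
    rw [← mul_assoc]
    refine mul_le_mul_of_nonneg_right ?_ (qf_nonneg H α r)
    have k1 := K_bd H.hT H.hδ H.hη r t
    have k2 := K_bd' H.hT H.hδ H.hη r (t + T)
    rw [← hb] at k1 k2
    nlinarith
  rw [hfun_eq, hfun_eq, ep, ← eq]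
  have m1 := mul_le_mul_of_nonneg_left hA (qf_nonneg H α (t + T))
  have m2 := mul_le_mul_of_nonneg_left hB (pf_nonneg H α t)
  nlinarith

lemma psi_T (H : Hyp T δ ηb c w) {α : ℝ → ℝ} (hα : MemM T ηb α) : psi T δ ηb c w α T = 0 := by
  rw [psi, h_zero H hα, neg_zero]

lemma psi_0 (α : ℝ → ℝ) : psi T δ ηb c w α 0 = 0 := by simp [psi]

lemma psi_sub (H : Hyp T δ ηb c w) {α : ℝ → ℝ} (hα : MemM T ηb α) (a b : ℝ) :
    psi T δ ηb c w α a - psi T δ ηb c w α b = ∫ t in a..b, hfun T δ ηb c w α t := by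
  rw [psi, psi, ← intervalIntegral.integral_add_adjacent_intervals (h_ii H hα 0 a) (h_ii H hα a b)]
  ring

lemma psi_tail (H : Hyp T δ ηb c w) {α : ℝ → ℝ} (hα : MemM T ηb α) (s : ℝ) :
    ∫ t in s..T, hfun T δ ηb c w α t = psi T δ ηb c w α s := by
  rw [← psi_sub H hα, psi_T H hα, sub_zero]

lemma psi_cont (H : Hyp T δ ηb c w) {α : ℝ → ℝ} (hα : MemM T ηb α) :
    Continuous (psi T δ ηb c w α) := by
  unfold psi
  exact (intervalIntegral.continuous_primitive (h_ii H hα) 0).neg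

lemma psi_diff (H : Hyp T δ ηb c w) {α : ℝ → ℝ} (hα : MemM T ηb α) (t : ℝ) :
    psi T δ ηb c w α (t + T) - psi T δ ηb c w α t =
      ∫ s in (0:ℝ)..t, (hfun T δ ηb c w α s - hfun T δ ηb c w α (s + T)) := by
  have h1 : IntervalIntegrable (fun s => hfun T δ ηb c w α (s + T)) volume 0 t := by
    have := (h_ii H hα (0 + T) (t + T)).comp_add_right T
    simpa using this
  rw [intervalIntegral.integral_sub (h_ii H hα 0 t) h1,
    intervalIntegral.integral_comp_add_right, ← psi_sub H hα, ← psi_sub H hα, zero_add,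
    psi_T H hα, psi_0]
  ring

lemma psi_up (H : Hyp T δ ηb c w) {α : ℝ → ℝ} (hα : MemM T ηb α) {t : ℝ} (ht : 0 ≤ t) :
    psi T δ ηb c w α t ≤ psi T δ ηb c w α (t + T) := by
  have := psi_diff H hα t
  have h2 : 0 ≤ ∫ s in (0:ℝ)..t, (hfun T δ ηb c w α s - hfun T δ ηb c w α (s + T)) :=
    intervalIntegral.integral_nonneg ht fun s _ => sub_nonneg.2 (h_step H hα s)
  linarith

lemma psi_down (H : Hyp T δ ηb c w) {α : ℝ → ℝ} (hα : MemM T ηb α) {t : ℝ} (ht : t ≤ 0) :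
    psi T δ ηb c w α (t + T) ≤ psi T δ ηb c w α t := by
  have := psi_diff H hα t
  rw [intervalIntegral.integral_symm] at this
  have h2 : 0 ≤ ∫ s in t..0, (hfun T δ ηb c w α s - hfun T δ ηb c w α (s + T)) :=
    intervalIntegral.integral_nonneg ht fun s _ => sub_nonneg.2 (h_step H hα s)
  linarith

lemma psi_n (H : Hyp T δ ηb c w) {α : ℝ → ℝ} (hα : MemM T ηb α) {u : ℝ} (hu : u ∈ Icc 0 T)
    (n : ℤ) : psi T δ ηb c w α u ≤ psi T δ ηb c w α (u + n * T) := by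
  have hT := H.hT
  induction n using Int.induction_on with
  | zero => simp
  | succ n ih =>
    refine ih.trans ?_
    rw [show u + (((n : ℤ) + 1 : ℤ) : ℝ) * T = u + ((n : ℤ) : ℝ) * T + T by push_cast; ring]
    have := psi_up H hα (t := u + (n : ℤ) * T) (by have := hu.1; push_cast; positivity)
    exact this
  | pred n ih =>
    refine ih.trans ?_
    rw [show u + ((-(n : ℤ) : ℤ) : ℝ) * T = u + ((-(n : ℤ) - 1 : ℤ) : ℝ) * T + T by push_cast; ring]
    have := psi_down H hα (t := u + ((-(n : ℤ) - 1 : ℤ) : ℝ) * T) (by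
      have := hu.2; push_cast
      have : (0:ℝ) ≤ n * T := by positivity
      linarith)
    exact this

noncomputable def Gf (T δ ηb : ℝ) (c w α : ℝ → ℝ) (z : ℝ × ℝ) : ℝ :=
  Kker T δ ηb z.1 z.2 * (qf δ w α z.1 * pf δ c α z.2)

lemma Gf_nonneg (H : Hyp T δ ηb c w) (α : ℝ → ℝ) (z : ℝ × ℝ) : 0 ≤ Gf T δ ηb c w α z :=
  mul_nonneg (K_nonneg H.hT H.hδ H.hη _ _) (mul_nonneg (qf_nonneg H α _) (pf_nonneg H α _))

lemma Gf_int (H : Hyp T δ ηb c w) {α : ℝ → ℝ} (hα : MemM T ηb α) :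
    Integrable (Gf T δ ηb c w α)
      ((volume.restrict (Ioc 0 T)).prod (volume.restrict (Ioc 0 T))) ∧
    ∫ z, Gf T δ ηb c w α z
      ∂((volume.restrict (Ioc 0 T)).prod (volume.restrict (Ioc 0 T))) = Phi T δ ηb c w α := by
  obtain ⟨h0, h1, h2⟩ := fub H.hT H.hδ H.hη (qf_ii H hα 0 T) (pf_ii H hα 0 T)
  rw [Phi_eq]
  exact ⟨h0, h1⟩

lemma Gf_exp (α β : ℝ → ℝ) (z : ℝ × ℝ) : Gf T δ ηb c w β z =
    Gf T δ ηb c w α z * Real.exp ((β z.2 - α z.2) - (β z.1 - α z.1)) := by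
  simp only [Gf, qf, pf]
  have : Real.exp (-(β z.1) - δ * z.1) * Real.exp (β z.2 + δ * z.2) =
    Real.exp (-(α z.1) - δ * z.1) * Real.exp (α z.2 + δ * z.2) *
      Real.exp ((β z.2 - α z.2) - (β z.1 - α z.1)) := by
    rw [← Real.exp_add, ← Real.exp_add, ← Real.exp_add]; congr 1; ring
  linear_combination (Kker T δ ηb z.1 z.2 * w z.1 * c z.2) * this

lemma Gf_lin (H : Hyp T δ ηb c w) {α β : ℝ → ℝ} (hα : MemM T ηb α) (hβ : MemM T ηb β) :
    Integrable (fun z => Gf T δ ηb c w α z * ((β z.2 - α z.2) - (β z.1 - α z.1)))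
      ((volume.restrict (Ioc 0 T)).prod (volume.restrict (Ioc 0 T))) ∧
    ∫ z, Gf T δ ηb c w α z * ((β z.2 - α z.2) - (β z.1 - α z.1))
      ∂((volume.restrict (Ioc 0 T)).prod (volume.restrict (Ioc 0 T))) =
      (∫ t in (0:ℝ)..T, hfun T δ ηb c w α t * α t) -
      (∫ t in (0:ℝ)..T, hfun T δ ηb c w α t * β t) := by
  have hp := pf_ii H hα 0 T
  have hq := qf_ii H hα 0 T
  have hpg : IntervalIntegrable (fun t => pf δ c α t * (β t - α t)) volume 0 T := by
    simp only [mul_sub]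
    exact (ii_mul_mono hp hβ.1).sub (ii_mul_mono hp hα.1)
  have hqg : IntervalIntegrable (fun t => qf δ w α t * (β t - α t)) volume 0 T := by
    simp only [mul_sub]
    exact (ii_mul_mono hq hβ.1).sub (ii_mul_mono hq hα.1)
  obtain ⟨a0, _, a2⟩ := fub H.hT H.hδ H.hη hq hpg
  obtain ⟨b0, b1, _⟩ := fub H.hT H.hδ H.hη hqg hp
  have e : (fun z : ℝ × ℝ => Gf T δ ηb c w α z * ((β z.2 - α z.2) - (β z.1 - α z.1))) =
    fun z => Kker T δ ηb z.1 z.2 * (qf δ w α z.1 * (pf δ c α z.2 * (β z.2 - α z.2))) -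
      Kker T δ ηb z.1 z.2 * (qf δ w α z.1 * (β z.1 - α z.1) * pf δ c α z.2) := by
    ext z; simp only [Gf]; ring
  rw [e]
  refine ⟨a0.sub b0, ?_⟩
  rw [MeasureTheory.integral_sub a0 b0, a2, b1]
  rw [← intervalIntegral.integral_sub, ← intervalIntegral.integral_sub]
  · refine intervalIntegral.integral_congr fun t _ => ?_
    simp only [hfun_eq]; ring
  · exact ii_mul_mono (h_ii H hα 0 T) hα.1
  · exact ii_mul_mono (h_ii H hα 0 T) hβ.1
  · exact ii_mul_anti hpg (B_anti H.hT H.hδ H.hη (qf_nonneg H α) hq)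
  · exact ii_mul_mono hqg (A_mono H.hT H.hδ H.hη (pf_nonneg H α) hp)

lemma lower (H : Hyp T δ ηb c w) {α β : ℝ → ℝ} (hα : MemM T ηb α) (hβ : MemM T ηb β) :
    Phi T δ ηb c w α + ((∫ t in (0:ℝ)..T, hfun T δ ηb c w α t * α t) -
      (∫ t in (0:ℝ)..T, hfun T δ ηb c w α t * β t)) ≤ Phi T δ ηb c w β := by
  obtain ⟨a0, a1⟩ := Gf_int H hα
  obtain ⟨b0, b1⟩ := Gf_int H hβ
  obtain ⟨d0, d1⟩ := Gf_lin H hα hβ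
  rw [← a1, ← b1, ← d1, ← MeasureTheory.integral_add a0 d0]
  refine MeasureTheory.integral_mono (a0.add d0) b0 fun z => ?_
  simp only
  rw [Gf_exp α β z]
  have := mul_le_mul_of_nonneg_left
    (Real.add_one_le_exp ((β z.2 - α z.2) - (β z.1 - α z.1))) (Gf_nonneg H α z)
  linarith

lemma mem_bd (H : Hyp T δ ηb c w) {α : ℝ → ℝ} (hα : MemM T ηb α) {t : ℝ} (ht : t ∈ Ioc 0 T) :
    0 ≤ α t ∧ α t ≤ T * ηb := by
  constructor
  · rw [← hα.2.2.1]; exact hα.1 ht.1.le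
  · rw [← hα.2.2.2.2]; exact hα.1 ht.2

lemma mem_comb {α β : ℝ → ℝ} (hα : MemM T ηb α) (hβ : MemM T ηb β) {e : ℝ} (he : 0 ≤ e)
    (he1 : e ≤ 1) : MemM T ηb (fun t => (1 - e) * α t + e * β t) := by
  obtain ⟨a1, a2, a3, a4, a5⟩ := hα
  obtain ⟨b1, b2, b3, b4, b5⟩ := hβ
  refine ⟨?_, ?_, ?_, ?_, ?_⟩
  · intro x y h
    have h1 := mul_le_mul_of_nonneg_left (a1 h) (sub_nonneg.2 he1)
    have h2 := mul_le_mul_of_nonneg_left (b1 h) he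
    simp only; linarith
  · intro t
    exact ((a2 t).const_mul _).add ((b2 t).const_mul _)
  · simp [a3, b3]
  · intro t; simp only [a4, b4]; ring
  · simp only [a5, b5]; ring

lemma upper (H : Hyp T δ ηb c w) {α β : ℝ → ℝ} (hα : MemM T ηb α) (hβ : MemM T ηb β)
    (hopt : ∀ β, MemM T ηb β → Phi T δ ηb c w α ≤ Phi T δ ηb c w β) :
    (∫ t in (0:ℝ)..T, hfun T δ ηb c w α t * β t) ≤
      ∫ t in (0:ℝ)..T, hfun T δ ηb c w α t * α t := by
  obtain ⟨a0, a1⟩ := Gf_int H hα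
  obtain ⟨d0, d1⟩ := Gf_lin H hα hβ
  set D := (∫ t in (0:ℝ)..T, hfun T δ ηb c w α t * α t) -
      (∫ t in (0:ℝ)..T, hfun T δ ηb c w α t * β t) with hD
  suffices 0 ≤ D by linarith
  set R := T * ηb with hR
  have hR0 : 0 < R := mul_pos H.hT H.hη
  set P0 := Phi T δ ηb c w α
  have hP0 : 0 ≤ P0 := by rw [← a1]; exact MeasureTheory.integral_nonneg (Gf_nonneg H α)
  have key : ∀ e : ℝ, 0 < e → e ≤ 1 → e * (2 * R) ≤ 1 → 0 ≤ D + e * ((2 * R) ^ 2 * P0) := by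
    intro e he he1 heR
    have hm := mem_comb hα hβ he.le he1
    obtain ⟨b0, b1⟩ := Gf_int H hm
    have h1 := hopt _ hm
    have h2 : Phi T δ ηb c w (fun t => (1 - e) * α t + e * β t) ≤
        P0 + e * D + e ^ 2 * (2 * R) ^ 2 * P0 := by
      have hs : Integrable (fun z => Gf T δ ηb c w α z +
          e * (Gf T δ ηb c w α z * ((β z.2 - α z.2) - (β z.1 - α z.1))))
          ((volume.restrict (Ioc 0 T)).prod (volume.restrict (Ioc 0 T))) :=
        a0.add (d0.const_mul e)
      rw [← b1, ← d1, ← a1, ← MeasureTheory.integral_const_mul,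
        ← MeasureTheory.integral_const_mul,
        ← MeasureTheory.integral_add a0 (d0.const_mul e),
        ← MeasureTheory.integral_add hs (a0.const_mul _)]
      refine MeasureTheory.integral_mono_ae b0
        (hs.add (a0.const_mul _)) ?_
      rw [Measure.prod_restrict]
      refine (ae_restrict_iff' (measurableSet_Ioc.prod measurableSet_Ioc)).2
        (ae_of_all _ fun z hz => ?_)
      simp only [Pi.add_apply]
      rw [Gf_exp α]
      set d := (β z.2 - α z.2) - (β z.1 - α z.1) with hd
      have hx : ((1 - e) * α z.2 + e * β z.2 - α z.2) - ((1 - e) * α z.1 + e * β z.1 - α z.1)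
        = e * d := by rw [hd]; ring
      rw [hx]
      have hdR : |d| ≤ 2 * R := by
        have := mem_bd H hα hz.1
        have := mem_bd H hα hz.2
        have := mem_bd H hβ hz.1
        have := mem_bd H hβ hz.2
        rw [abs_le]; constructor <;> linarith
      have hed : |e * d| ≤ 1 := by
        rw [abs_mul, abs_of_pos he]
        exact (mul_le_mul_of_nonneg_left hdR he.le).trans heR
      have h3 := (abs_le.1 (Real.abs_exp_sub_one_sub_id_le hed)).2
      have h4 : (e * d) ^ 2 ≤ e ^ 2 * (2 * R) ^ 2 := by
        rw [mul_pow]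
        refine mul_le_mul_of_nonneg_left ?_ (sq_nonneg e)
        exact sq_le_sq.2 (by rwa [abs_of_pos (by positivity : 0 < 2 * R)])
      have h5 : Real.exp (e * d) ≤ 1 + e * d + e ^ 2 * (2 * R) ^ 2 := by linarith
      have := mul_le_mul_of_nonneg_left h5 (Gf_nonneg H α z)
      linarith
    have h3 : 0 ≤ e * (D + e * ((2 * R) ^ 2 * P0)) := by linarith
    exact nonneg_of_mul_nonneg_right h3 he
  have ht : Tendsto (fun e : ℝ => D + e * ((2 * R) ^ 2 * P0)) (𝓝[>] 0) (𝓝 D) := by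
    have : Continuous (fun e : ℝ => D + e * ((2 * R) ^ 2 * P0)) := by fun_prop
    have h := this.tendsto 0
    simp only [zero_mul, add_zero] at h
    exact h.mono_left nhdsWithin_le_nhds
  refine ge_of_tendsto ht ?_
  have hpos : 0 < min 1 (1 / (2 * R)) := by positivity
  filter_upwards [Ioo_mem_nhdsGT hpos] with e he
  refine key e he.1 (he.2.le.trans (min_le_left _ _)) ?_
  have := he.2.le.trans (min_le_right _ _)
  rwa [le_div_iff₀ (by positivity)] at this

end

section
variable {T δ ηb : ℝ} {c w : ℝ → ℝ}

noncomputable def bfun (T ηb s0 t : ℝ) : ℝ := T * ηb * ((⌊(t - s0) / T⌋ : ℝ) + 1)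

lemma bfun_mem (hT : 0 < T) (hη : 0 < ηb) {s0 : ℝ} (hs : s0 ∈ Ioc 0 T) :
    MemM T ηb (bfun T ηb s0) := by
  have hp : ∀ t, (t + T - s0) / T = (t - s0) / T + 1 := fun t => by field_simp; ring
  have h0 : ⌊(0 - s0) / T⌋ = -1 := by
    rw [Int.floor_eq_iff]
    push_cast
    rw [le_div_iff₀ hT, div_lt_iff₀ hT]
    constructor <;> linarith [hs.1, hs.2]
  have hz : bfun T ηb s0 0 = 0 := by rw [bfun, h0]; simp
  have hst : ∀ t, bfun T ηb s0 (t + T) = bfun T ηb s0 t + T * ηb := by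
    intro t; rw [bfun, bfun, hp, Int.floor_add_one]; push_cast; ring
  have hTT : bfun T ηb s0 T = T * ηb := by
    have := hst 0
    rwa [zero_add, hz, zero_add] at this
  refine ⟨?_, ?_, hz, ?_, hTT⟩
  · intro x y h
    unfold bfun
    have : (⌊(x - s0) / T⌋ : ℝ) ≤ ⌊(y - s0) / T⌋ := by
      exact_mod_cast Int.floor_mono (by gcongr)
    gcongr
  · intro t
    have h1 : Tendsto (fun x => (x - s0) / T) (𝓝[≥] t) (𝓝[≥] ((t - s0) / T)) := by
      refine tendsto_nhdsWithin_iff.2 ⟨?_, ?_⟩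
      · have : Continuous (fun x : ℝ => (x - s0) / T) := by fun_prop
        exact (this.tendsto t).mono_left nhdsWithin_le_nhds
      · filter_upwards [self_mem_nhdsWithin] with x hx
        have : t ≤ x := hx
        simp only [mem_Ici]
        gcongr
    have h2 := (tendsto_floor_right_pure_floor ((t - s0) / T)).comp h1
    have h3 : ∀ᶠ x in 𝓝[≥] t, ⌊(x - s0) / T⌋ = ⌊(t - s0) / T⌋ := by
      have := tendsto_pure.1 h2
      simpa using this
    refine (continuousWithinAt_const (b := bfun T ηb s0 t)).congr_of_eventuallyEq ?_ rfl
    filter_upwards [h3] with x hx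
    simp only [bfun, hx]
  · intro t; rw [hst, hTT]

lemma bfun_int (H : Hyp T δ ηb c w) {α : ℝ → ℝ} (hα : MemM T ηb α) {s0 : ℝ} (hs : s0 ∈ Ioc 0 T) :
    ∫ t in (0:ℝ)..T, hfun T δ ηb c w α t * bfun T ηb s0 t =
      psi T δ ηb c w α s0 * (T * ηb) := by
  have hT := H.hT
  have hm := bfun_mem hT H.hη hs
  have hi : ∀ a b, IntervalIntegrable (fun t => hfun T δ ηb c w α t * bfun T ηb s0 t) volume a b :=
    fun a b => ii_mul_mono (h_ii H hα a b) hm.1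
  rw [← intervalIntegral.integral_add_adjacent_intervals (hi 0 s0) (hi s0 T)]
  have e1 : ∫ t in (0:ℝ)..s0, hfun T δ ηb c w α t * bfun T ηb s0 t = 0 := by
    rw [intervalIntegral.integral_of_le hs.1.le, integral_Ioc_eq_integral_Ioo]
    rw [setIntegral_congr_fun (g := fun _ => (0:ℝ)) measurableSet_Ioo]
    · simp
    · intro t ht
      have h0 : ⌊(t - s0) / T⌋ = -1 := by
        rw [Int.floor_eq_iff]
        push_cast
        rw [le_div_iff₀ hT, div_lt_iff₀ hT]
        constructor <;> linarith [hs.1, hs.2, ht.1, ht.2]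
      simp [bfun, h0]
  have e2 : ∫ t in s0..T, hfun T δ ηb c w α t * bfun T ηb s0 t =
      ∫ t in s0..T, hfun T δ ηb c w α t * (T * ηb) := by
    rw [intervalIntegral.integral_of_le hs.2, intervalIntegral.integral_of_le hs.2,
      integral_Ioc_eq_integral_Ioo, integral_Ioc_eq_integral_Ioo]
    refine setIntegral_congr_fun measurableSet_Ioo fun t ht => ?_
    have h0 : ⌊(t - s0) / T⌋ = 0 := by
      rw [Int.floor_eq_iff]
      push_cast
      rw [le_div_iff₀ hT, div_lt_iff₀ hT]
      constructor <;> linarith [hs.1, hs.2, ht.1, ht.2]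
    simp [bfun, h0]
  rw [e1, e2, intervalIntegral.integral_mul_const, psi_tail H hα, zero_add]

lemma int_psi (H : Hyp T δ ηb c w) {α β : ℝ → ℝ} (hα : MemM T ηb α) (hβ : MemM T ηb β) :
    ∫ t in (0:ℝ)..T, hfun T δ ηb c w α t * β t =
      ∫ s in Ioc 0 T, psi T δ ηb c w α s ∂(stj hβ).measure := by
  rw [stj_fub H.hT hβ (h_ii H hα 0 T)]
  simp only [psi_tail H hα]

lemma psi_intble (H : Hyp T δ ηb c w) {α β : ℝ → ℝ} (hα : MemM T ηb α) (hβ : MemM T ηb β) :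
    IntegrableOn (psi T δ ηb c w α) (Ioc 0 T) (stj hβ).measure :=
  ((psi_cont H hα).continuousOn.integrableOn_compact isCompact_Icc).mono_set Ioc_subset_Icc_self

lemma int_const {β : ℝ → ℝ} (hT : 0 < T) (hη : 0 < ηb) (hβ : MemM T ηb β) (m : ℝ) :
    ∫ _ in Ioc 0 T, m ∂(stj hβ).measure = m * (T * ηb) := by
  rw [setIntegral_const, Measure.real, stj_Ioc, hβ.2.2.1, hβ.2.2.2.2, sub_zero,
    ENNReal.toReal_ofReal (by positivity), smul_eq_mul, mul_comm]

lemma const_intble {β : ℝ → ℝ} (hβ : MemM T ηb β) (m : ℝ) :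
    IntegrableOn (fun _ => m) (Ioc 0 T) (stj hβ).measure :=
  (continuous_const.continuousOn.integrableOn_compact isCompact_Icc).mono_set Ioc_subset_Icc_self

lemma psi_max (H : Hyp T δ ηb c w) {α : ℝ → ℝ} (hα : MemM T ηb α) :
    ∃ s0 ∈ Ico 0 T, ∃ s1 ∈ Ioc 0 T, psi T δ ηb c w α s0 = psi T δ ηb c w α s1 ∧
      ∀ s ∈ Icc 0 T, psi T δ ηb c w α s ≤ psi T δ ηb c w α s0 := by
  have hT := H.hT
  obtain ⟨x, hx, hm⟩ := isCompact_Icc.exists_isMaxOn (nonempty_Icc.2 hT.le)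
    (psi_cont H hα).continuousOn
  have hm' : ∀ s ∈ Icc 0 T, psi T δ ηb c w α s ≤ psi T δ ηb c w α x := hm
  have h0T : psi T δ ηb c w α 0 = psi T δ ηb c w α T := by rw [psi_0, psi_T H hα]
  rcases eq_or_lt_of_le hx.1 with h | h
  · exact ⟨0, ⟨le_rfl, hT⟩, T, ⟨hT, le_rfl⟩, h0T, fun s hs => (hm' s hs).trans_eq (by rw [h])⟩
  rcases eq_or_lt_of_le hx.2 with h' | h'
  · exact ⟨0, ⟨le_rfl, hT⟩, T, ⟨hT, le_rfl⟩, h0T, fun s hs => (hm' s hs).trans_eq (by rw [h', h0T])⟩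
  · exact ⟨x, ⟨h.le, h'⟩, x, ⟨h, h'.le⟩, rfl, hm'⟩

lemma supp_per {α : ℝ → ℝ} (hα : MemM T ηb α) {t : ℝ} (n : ℤ) (ht : t + n * T ∈ SuppM α) :
    t ∈ SuppM α := by
  have hs : ∀ n : ℤ, ∀ x, α (x + n * T) = α x + n * α T := by
    intro n x
    induction n using Int.induction_on with
    | zero => simp
    | succ n ih =>
      rw [show x + (((n : ℤ) + 1 : ℤ) : ℝ) * T = x + ((n : ℤ) : ℝ) * T + T by push_cast; ring,
        hα.2.2.2.1, ih]
      push_cast; ring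
    | pred n ih =>
      rw [show x + ((-(n : ℤ) : ℤ) : ℝ) * T = x + ((-(n : ℤ) - 1 : ℤ) : ℝ) * T + T by
        push_cast; ring, hα.2.2.2.1] at ih
      push_cast at ih ⊢
      linarith
  intro ε hε
  have := ht ε hε
  rw [show t + n * T + ε = (t + ε) + n * T by ring, show t + n * T - ε = (t - ε) + n * T by ring,
    hs, hs] at this
  linarith

lemma suff (H : Hyp T δ ηb c w) {α : ℝ → ℝ} (hα : MemM T ηb α)
    (h : ∀ t ∈ SuppM α, ∀ s ∈ Set.Ico (0:ℝ) T, psi T δ ηb c w α s ≤ psi T δ ηb c w α t)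
    {β : ℝ → ℝ} (hβ : MemM T ηb β) : Phi T δ ηb c w α ≤ Phi T δ ηb c w β := by
  have hl := lower H hα hβ
  rw [int_psi H hα hα, int_psi H hα hβ] at hl
  obtain ⟨s0, hs0, -, -, -, hm⟩ := psi_max H hα
  have h1 : psi T δ ηb c w α s0 * (T * ηb) ≤
      ∫ s in Ioc 0 T, psi T δ ηb c w α s ∂(stj hα).measure := by
    rw [← int_const H.hT H.hη hα]
    refine MeasureTheory.integral_mono_ae (const_intble hα _) (psi_intble H hα hα) ?_
    refine ae_restrict_of_ae ?_
    have hnull : (stj hα).measure (SuppM α)ᶜ = 0 := by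
      refine measure_null_of_locally_null _ fun x hx => ?_
      simp only [SuppM, mem_compl_iff, mem_ofPred_eq, not_forall, not_lt] at hx
      obtain ⟨ε, hε, hx⟩ := hx
      refine ⟨Ioc (x - ε) (x + ε), mem_nhdsWithin_of_mem_nhds
        (Ioc_mem_nhds (by linarith) (by linarith)), ?_⟩
      rw [stj_Ioc, ENNReal.ofReal_eq_zero]
      exact hx
    have : ∀ᵐ x ∂(stj hα).measure, x ∈ SuppM α := hnull
    filter_upwards [this] with x hx
    exact h x hx s0 hs0
  have h2 : ∫ s in Ioc 0 T, psi T δ ηb c w α s ∂(stj hβ).measure ≤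
      psi T δ ηb c w α s0 * (T * ηb) := by
    rw [← int_const H.hT H.hη hβ]
    exact MeasureTheory.setIntegral_mono_on (psi_intble H hα hβ) (const_intble hβ _)
      measurableSet_Ioc fun s hs => hm s (Ioc_subset_Icc_self hs)
  linarith

lemma nec (H : Hyp T δ ηb c w) {α : ℝ → ℝ} (hα : MemM T ηb α)
    (hopt : ∀ β, MemM T ηb β → Phi T δ ηb c w α ≤ Phi T δ ηb c w β) :
    ∀ t ∈ SuppM α, ∀ s ∈ Set.Ico (0:ℝ) T, psi T δ ηb c w α s ≤ psi T δ ηb c w α t := by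
  have hT := H.hT
  obtain ⟨s0, hs0, s1, hs1, he, hm⟩ := psi_max H hα
  have h1 := upper H hα (bfun_mem hT H.hη hs1) hopt
  rw [bfun_int H hα hs1, int_psi H hα hα, ← he] at h1
  set m := psi T δ ηb c w α s0 with hmdef
  rw [← int_const hT H.hη hα] at h1
  have hi : IntegrableOn (fun s => m - psi T δ ηb c w α s) (Ioc 0 T) (stj hα).measure :=
    (const_intble hα m).sub (psi_intble H hα hα)
  have hnn : 0 ≤ᵐ[(stj hα).measure.restrict (Ioc 0 T)] (fun s => m - psi T δ ηb c w α s) :=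
    (ae_restrict_iff' measurableSet_Ioc).2 (ae_of_all _ fun s hs =>
      sub_nonneg.2 (hm s (Ioc_subset_Icc_self hs)))
  have hz : ∫ s in Ioc 0 T, (m - psi T δ ηb c w α s) ∂(stj hα).measure = 0 := by
    refine le_antisymm ?_ (MeasureTheory.integral_nonneg_of_ae hnn)
    rw [MeasureTheory.integral_sub (const_intble hα m) (psi_intble H hα hα)]
    linarith
  have hae := (MeasureTheory.integral_eq_zero_iff_of_nonneg_ae hnn hi).1 hz
  have hae' := (ae_restrict_iff' measurableSet_Ioc).1 hae
  have hconst : ∀ a b, 0 ≤ a → a ≤ b → b ≤ T → (∀ s ∈ Ioc a b, psi T δ ηb c w α s < m) →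
      α b ≤ α a := by
    intro a b ha hab hb hlt
    have : (stj hα).measure (Ioc a b) = 0 := by
      refine measure_mono_null ?_ hae'
      intro s hs hcon
      have h2 := hcon ⟨ha.trans_lt hs.1, hs.2.trans hb⟩
      have h3 := hlt s hs
      simp only [Pi.zero_apply] at h2
      linarith
    rw [stj_Ioc, ENNReal.ofReal_eq_zero] at this
    linarith
  have hopen : IsOpen {s | psi T δ ηb c w α s < m} :=
    isOpen_lt (psi_cont H hα) continuous_const
  have hmain : ∀ t ∈ Ioc 0 T, t ∈ SuppM α → m ≤ psi T δ ηb c w α t := by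
    intro t ht hsupp
    by_contra! hlt
    obtain ⟨ε, hε, hball⟩ := Metric.isOpen_iff.1 hopen t hlt
    have hball' : ∀ s, |s - t| < ε → psi T δ ηb c w α s < m := fun s hs =>
      hball (by rwa [Metric.mem_ball, Real.dist_eq])
    rcases eq_or_lt_of_le ht.2 with h | h
    · subst h
      have h0 : psi t δ ηb c w α 0 < m := by
        rw [psi_0, ← psi_T H hα]; exact hlt
      obtain ⟨ε', hε', hb2⟩ := Metric.isOpen_iff.1 hopen 0 h0
      have hb2' : ∀ s, |s| < ε' → psi t δ ηb c w α s < m := fun s hs =>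
        hb2 (by rwa [Metric.mem_ball, Real.dist_eq, sub_zero])
      set e := min t (min (ε / 2) (ε' / 2)) with hedef
      have he0 : 0 < e := by positivity
      have e1 : e ≤ t := min_le_left _ _
      have e2 : e ≤ ε / 2 := (min_le_right _ _).trans (min_le_left _ _)
      have e3 : e ≤ ε' / 2 := (min_le_right _ _).trans (min_le_right _ _)
      have c1 := hconst (t - e) t (by linarith) (by linarith) le_rfl fun s hs => by
        apply hball'; rw [abs_lt]; constructor <;> linarith [hs.1, hs.2]
      have c2 := hconst 0 e le_rfl he0.le e1 fun s hs => by
        apply hb2'; rw [abs_lt]; constructor <;> linarith [hs.1, hs.2]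
      have c3 := hsupp e he0
      rw [add_comm, hα.2.2.2.1] at c3
      have := hα.2.2.1
      linarith
    · set e := min (min t (T - t)) (ε / 2) with hedef
      have he0 : 0 < e := by
        have := ht.1
        have : 0 < T - t := by linarith
        positivity
      have e1 : e ≤ t := (min_le_left _ _).trans (min_le_left _ _)
      have e2 : e ≤ T - t := (min_le_left _ _).trans (min_le_right _ _)
      have e3 : e ≤ ε / 2 := min_le_right _ _
      have c1 := hconst (t - e) (t + e) (by linarith) (by linarith) (by linarith) fun s hs => by
        apply hball'; rw [abs_lt]; constructor <;> linarith [hs.1, hs.2]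
      have c3 := hsupp e he0
      linarith
  intro t ht s hs
  refine (hm s (Ico_subset_Icc_self hs)).trans ?_
  obtain ⟨n, hn, -⟩ := existsUnique_sub_zsmul_mem_Ioc hT t 0
  rw [zsmul_eq_mul, zero_add] at hn
  have hu : t = (t - n * T) + n * T := by ring
  have hu2 : t - n * T ∈ SuppM α := supp_per hα n (by rw [← hu]; exact ht)
  refine (hmain _ hn hu2).trans ?_
  have := psi_n H hα (Ioc_subset_Icc_self hn) n
  rwa [← hu] at this

end

theorem stmt7 (T δ ηb : ℝ) (c w α : ℝ → ℝ)
    (hT : 0 < T) (hδ : 0 < δ) (hη : 0 < ηb)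
    (hc0 : ∀ t, 0 ≤ c t) (hcP : ∀ t, c (t + T) = c t) (hcI : IntegrableOn c (Set.Icc 0 T))
    (hw0 : ∀ t, 0 ≤ w t) (hwP : ∀ t, w (t + T) = w t) (hwI : IntegrableOn w (Set.Icc 0 T))
    (hcne : ¬ c =ᵐ[volume.restrict (Set.Icc (0:ℝ) T)] 0)
    (hwne : ¬ w =ᵐ[volume.restrict (Set.Icc (0:ℝ) T)] 0)
    (hpos : (∀ᵐ t ∂volume, 0 < c t) ∨ (∀ᵐ t ∂volume, 0 < w t))
    (hα : MemM T ηb α) :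
    (∀ β, MemM T ηb β → Phi T δ ηb c w α ≤ Phi T δ ηb c w β) ↔
      (∀ t ∈ SuppM α, ∀ s ∈ Set.Ico (0:ℝ) T,
        psi T δ ηb c w α s ≤ psi T δ ηb c w α t) := by
  have H : Hyp T δ ηb c w := ⟨hT, hδ, hη, hc0, hcP, hcI, hw0, hwP, hwI⟩
  exact ⟨fun h => nec H hα h, fun h β hβ => suff H hα h hβ⟩
end

section
/- Pure atomic optimizer for small effort under monotone inflow: assume w ≡ 1 and c is strictly monotone increasing on (0,T) (with its T-periodic extension having a downward jump at t* = T, i.e., c(T−) > c(0+)). Then for sufficiently small η̄ > 0, the minimizer is α_opt(t) = 0 for 0 ≤ t < T and α_opt(T) = η̄T, i.e., μ_opt consists of point masses of size η̄T at the points kT, k ∈ ℤ. A sufficient explicit condition is η̄ < (1/T)·ln( [(e^{δt}−1)∫ₜᵀ c(r)e^{δr}dr] / [(e^{δT}−e^{δt})∫₀ᵗ c(r)e^{δr}dr] ) for all t ∈ (0,T), and the right-hand side is strictly positive for each t ∈ (0,T) by the integral mean value theorem and the strict monotonicity of c. -/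
open MeasureTheory intervalIntegral Real Set Filter Topology

lemma aux_ii (T δ : ℝ) (c : ℝ → ℝ) (hcI : IntegrableOn c (Set.Icc 0 T)) (a b : ℝ)
    (ha : 0 ≤ a) (hab : a ≤ b) (hb : b ≤ T) :
    IntervalIntegrable (fun r => c r * Real.exp (δ * r)) volume a b := by
  have h1 : IntervalIntegrable c volume a b := by
    rw [intervalIntegrable_iff_integrableOn_Icc_of_le hab]
    exact hcI.mono_set (Icc_subset_Icc ha hb)
  exact h1.mul_continuousOn (by fun_prop)

lemma aux_exp (δ : ℝ) (hδ : 0 < δ) (a b : ℝ) :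
    ∫ r in a..b, Real.exp (δ * r) = (Real.exp (δ * b) - Real.exp (δ * a)) / δ := by
  rw [intervalIntegral.integral_comp_mul_left (fun x => Real.exp x) hδ.ne', integral_exp,
    smul_eq_mul]
  field_simp

lemma aux_exp_neg (δ : ℝ) (hδ : 0 < δ) (a b : ℝ) :
    ∫ r in a..b, Real.exp (-(δ * r)) = (Real.exp (-(δ * a)) - Real.exp (-(δ * b))) / δ := by
  have h := intervalIntegral.integral_comp_mul_left (a := a) (b := b) (fun x => Real.exp x) (c := -δ)
    (by linarith : -δ < 0).ne
  simp only [neg_mul] at h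
  rw [h, integral_exp, smul_eq_mul]
  field_simp
  ring

lemma aux_lt (T δ : ℝ) (c : ℝ → ℝ) (hδ : 0 < δ)
    (hcI : IntegrableOn c (Set.Icc 0 T)) (hmono : StrictMonoOn c (Set.Ioo 0 T))
    (a b d : ℝ) (ha : 0 ≤ a) (hab : a < b) (hbd : b < d) (hd : d ≤ T) :
    (∫ r in a..b, c r * Real.exp (δ * r)) * (Real.exp (δ * d) - Real.exp (δ * b)) <
    (∫ r in b..d, c r * Real.exp (δ * r)) * (Real.exp (δ * b) - Real.exp (δ * a)) := by
  have hb : b ∈ Ioo 0 T := ⟨by linarith, by linarith⟩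
  have e1 : Real.exp (δ * a) < Real.exp (δ * b) := by
    apply Real.exp_lt_exp.2; nlinarith
  have e2 : Real.exp (δ * b) < Real.exp (δ * d) := by
    apply Real.exp_lt_exp.2; nlinarith
  have i1 : (∫ r in a..b, c r * Real.exp (δ * r)) < c b * ((Real.exp (δ * b) - Real.exp (δ * a)) / δ) := by
    rw [← aux_exp δ hδ, ← intervalIntegral.integral_const_mul]
    rw [← sub_pos, ← intervalIntegral.integral_sub
      (Continuous.intervalIntegrable (by fun_prop) _ _)
      (aux_ii T δ c hcI a b ha hab.le (by linarith))]
    refine intervalIntegral.intervalIntegral_pos_of_pos_on ?_ ?_ hab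
    · exact (Continuous.intervalIntegrable (by fun_prop) _ _).sub
        (aux_ii T δ c hcI a b ha hab.le (by linarith))
    · intro x hx
      have := hmono ⟨by linarith [hx.1], by linarith [hx.2]⟩ hb hx.2
      have := mul_lt_mul_of_pos_right this (Real.exp_pos (δ * x))
      simpa using this
  have i2 : c b * ((Real.exp (δ * d) - Real.exp (δ * b)) / δ) < (∫ r in b..d, c r * Real.exp (δ * r)) := by
    rw [← aux_exp δ hδ, ← intervalIntegral.integral_const_mul]
    rw [← sub_pos, ← intervalIntegral.integral_sub
      (aux_ii T δ c hcI b d hb.1.le hbd.le (by linarith))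
      (Continuous.intervalIntegrable (by fun_prop) _ _)]
    refine intervalIntegral.intervalIntegral_pos_of_pos_on ?_ ?_ hbd
    · exact (aux_ii T δ c hcI b d hb.1.le hbd.le (by linarith)).sub
        (Continuous.intervalIntegrable (by fun_prop) _ _)
    · intro x hx
      have := hmono hb ⟨by linarith [hx.1, hb.1], by linarith [hx.2]⟩ hx.1
      have := mul_lt_mul_of_pos_right this (Real.exp_pos (δ * x))
      simpa using this
  calc _ < c b * ((Real.exp (δ * b) - Real.exp (δ * a)) / δ) * (Real.exp (δ * d) - Real.exp (δ * b)) :=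
        mul_lt_mul_of_pos_right i1 (by linarith)
    _ = c b * ((Real.exp (δ * d) - Real.exp (δ * b)) / δ) * (Real.exp (δ * b) - Real.exp (δ * a)) := by ring
    _ < _ := mul_lt_mul_of_pos_right i2 (by linarith)

lemma aux_pos (T δ : ℝ) (c : ℝ → ℝ) (hcpos : ∀ t, 0 < c t)
    (hcI : IntegrableOn c (Set.Icc 0 T)) (a b : ℝ) (ha : 0 ≤ a) (hab : a < b) (hb : b ≤ T) :
    0 < ∫ r in a..b, c r * Real.exp (δ * r) :=
  intervalIntegral.intervalIntegral_pos_of_pos_on (aux_ii T δ c hcI a b ha hab.le hb)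
    (fun x _ => mul_pos (hcpos x) (Real.exp_pos _)) hab

lemma alpha0_mem (T η : ℝ) (hT : 0 < T) (hη : 0 < η) :
    MemM T η (fun t => η * T * (⌊t / T⌋ : ℤ)) := by
  refine ⟨?_, ?_, ?_, ?_, ?_⟩
  · intro x y hxy
    have : ⌊x / T⌋ ≤ ⌊y / T⌋ := Int.floor_le_floor (by gcongr)
    have : (⌊x / T⌋ : ℝ) ≤ ⌊y / T⌋ := by exact_mod_cast this
    dsimp only
    gcongr
  · intro t
    have h : (fun s : ℝ => η * T * (⌊s / T⌋ : ℤ)) =ᶠ[𝓝[≥] t] fun _ => η * T * (⌊t / T⌋ : ℤ) := by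
      have hlt : t < (⌊t / T⌋ + 1) * T := by
        rw [← div_lt_iff₀ hT]; exact Int.lt_floor_add_one _
      filter_upwards [Ico_mem_nhdsGE hlt] with s hs
      have : ⌊s / T⌋ = ⌊t / T⌋ := by
        rw [Int.floor_eq_iff]
        constructor
        · exact (Int.floor_le _).trans (by gcongr; exact hs.1)
        · rw [div_lt_iff₀ hT]; exact hs.2
      rw [this]
    exact (continuousWithinAt_const (b := η * T * (⌊t / T⌋ : ℤ))).congr_of_eventuallyEq h rfl
  · simp
  · intro t
    have : (t + T) / T = t / T + 1 := by field_simp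
    simp only [this, Int.floor_add_one, div_self hT.ne', Int.floor_one]
    push_cast; ring
  · simp only [div_self hT.ne', Int.floor_one]
    push_cast; ring

noncomputable def nuM (T : ℝ) : Measure ℝ := volume.restrict (Ioo 0 T)

instance (T : ℝ) : IsFiniteMeasure (nuM T) := by unfold nuM; infer_instance

noncomputable def kk (T δ η : ℝ) (c : ℝ → ℝ) (p : ℝ × ℝ) : ℝ :=
  Kker T δ η p.1 p.2 * (Real.exp (-(δ * p.1)) * (c p.2 * Real.exp (δ * p.2)))

lemma int_nu (T : ℝ) (hT : 0 < T) (f : ℝ → ℝ) : ∫ t in (0:ℝ)..T, f t = ∫ t, f t ∂(nuM T) := by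
  rw [intervalIntegral.integral_of_le hT.le, integral_Ioc_eq_integral_Ioo]; rfl

lemma ae_nu (T : ℝ) : ∀ᵐ p ∂((nuM T).prod (nuM T)), p.1 ∈ Ioo 0 T ∧ p.2 ∈ Ioo 0 T := by
  unfold nuM
  rw [Measure.prod_restrict]
  exact ae_restrict_mem (measurableSet_Ioo.prod measurableSet_Ioo)

lemma Kker_nonneg (T δ η t r : ℝ) (hT : 0 < T) (hδ : 0 < δ) (hη : 0 < η) : 0 ≤ Kker T δ η t r := by
  have h1 : 0 < (η + δ) * T := by positivity
  unfold Kker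
  split_ifs
  · apply inv_nonneg.2
    have : Real.exp (-(η + δ) * T) ≤ 1 := Real.exp_le_one_iff.2 (by nlinarith)
    linarith
  · apply inv_nonneg.2
    have : 1 ≤ Real.exp ((η + δ) * T) := Real.one_le_exp (by nlinarith)
    linarith

lemma f_int (T δ : ℝ) (c : ℝ → ℝ) (hT : 0 < T) (hcI : IntegrableOn c (Set.Icc 0 T)) :
    Integrable (fun r => c r * Real.exp (δ * r)) (nuM T) := by
  have := aux_ii T δ c hcI 0 T le_rfl hT.le le_rfl
  rw [intervalIntegrable_iff_integrableOn_Ioo_of_le hT.le] at this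
  exact this

lemma e_int (T δ : ℝ) (hT : 0 < T) :
    Integrable (fun r => Real.exp (-(δ * r))) (nuM T) := by
  have : IntervalIntegrable (fun r => Real.exp (-(δ * r))) volume 0 T :=
    Continuous.intervalIntegrable (by fun_prop) _ _
  rw [intervalIntegrable_iff_integrableOn_Ioo_of_le hT.le] at this
  exact this

lemma kk_int (T δ η : ℝ) (c : ℝ → ℝ) (hT : 0 < T) (hcI : IntegrableOn c (Set.Icc 0 T)) :
    Integrable (kk T δ η c) ((nuM T).prod (nuM T)) := by
  have h := (e_int T δ hT).mul_prod (f_int T δ c hT hcI)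
  refine h.bdd_mul (c := |(1 - Real.exp (-(η + δ) * T))⁻¹| + |(Real.exp ((η + δ) * T) - 1)⁻¹|) ?_ ?_
  · apply Measurable.aestronglyMeasurable
    unfold Kker
    exact Measurable.ite (measurableSet_lt measurable_snd measurable_fst)
      measurable_const measurable_const
  · refine Eventually.of_forall fun p => ?_
    unfold Kker
    rw [Real.norm_eq_abs]
    split_ifs
    · linarith [abs_nonneg (Real.exp ((η + δ) * T) - 1)⁻¹]
    · linarith [abs_nonneg (1 - Real.exp (-(η + δ) * T))⁻¹]

lemma kkexp_int (T δ η : ℝ) (c β : ℝ → ℝ) (hT : 0 < T) (hcI : IntegrableOn c (Set.Icc 0 T))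
    (hβ : MemM T η β) :
    Integrable (fun p => kk T δ η c p * Real.exp (β p.2 - β p.1)) ((nuM T).prod (nuM T)) := by
  have hm := hβ.1.measurable
  refine (kk_int T δ η c hT hcI).mul_bdd (c := Real.exp (T * η)) ?_ ?_
  · exact (Real.measurable_exp.comp ((hm.comp measurable_snd).sub (hm.comp measurable_fst))).aestronglyMeasurable
  · filter_upwards [ae_nu T] with p hp
    rw [Real.norm_eq_abs, Real.abs_exp]
    apply Real.exp_le_exp.2
    have h1 := hβ.1 hp.2.2.le
    have h2 := hβ.1 hp.1.1.le
    rw [hβ.2.2.1] at h2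
    rw [hβ.2.2.2.2] at h1
    linarith

lemma Phi_eq_s19 (T δ η : ℝ) (c β : ℝ → ℝ) (hT : 0 < T) (hcI : IntegrableOn c (Set.Icc 0 T))
    (hβ : MemM T η β) :
    Phi T δ η c (fun _ => 1) β =
      ∫ p, kk T δ η c p * Real.exp (β p.2 - β p.1) ∂((nuM T).prod (nuM T)) := by
  rw [integral_prod _ (kkexp_int T δ η c β hT hcI hβ)]
  unfold Phi Sfun
  rw [int_nu T hT]
  congr 1
  ext t
  rw [int_nu T hT, one_mul, ← MeasureTheory.integral_const_mul]
  congr 1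
  ext r
  simp only [kk]
  rw [sub_eq_add_neg, Real.exp_add, Real.exp_add, Real.exp_sub, Real.exp_neg (β t)]
  field_simp

lemma J_nonneg (T δ η : ℝ) (c : ℝ → ℝ) (hT : 0 < T) (hδ : 0 < δ) (hη : 0 < η)
    (hcI : IntegrableOn c (Set.Icc 0 T)) (a : ℝ) (ha0 : 0 ≤ a) (haT : a ≤ T)
    (hc : Real.exp (η * T) * ((Real.exp (δ * T) - Real.exp (δ * a)) *
            ∫ r in (0:ℝ)..a, c r * Real.exp (δ * r)) ≤ (Real.exp (δ * a) - 1) *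
            (∫ r in a..T, c r * Real.exp (δ * r))) :
    0 ≤ ∫ p, kk T δ η c p * ((Ioi a).indicator 1 p.2 - (Ioi a).indicator 1 p.1)
      ∂((nuM T).prod (nuM T)) := by
  have key : ∀ p : ℝ × ℝ, kk T δ η c p * ((Ioi a).indicator 1 p.2 - (Ioi a).indicator 1 p.1) =
      (Real.exp ((η + δ) * T) - 1)⁻¹ * ((Iic a).indicator (fun t => Real.exp (-(δ * t))) p.1 *
        (Ioi a).indicator (fun r => c r * Real.exp (δ * r)) p.2) -
      (1 - Real.exp (-(η + δ) * T))⁻¹ * ((Ioi a).indicator (fun t => Real.exp (-(δ * t))) p.1 *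
        (Iic a).indicator (fun r => c r * Real.exp (δ * r)) p.2) := by
    rintro ⟨t, r⟩
    simp only [kk, Kker, indicator, mem_Ioi, mem_Iic, Pi.one_apply]
    by_cases h1 : a < r <;> by_cases h2 : a < t
    · simp [h1, h2, not_le.2 h1, not_le.2 h2]
    · have : ¬ r < t := by linarith
      simp [h1, h2, not_le.2 h1, not_lt.1 h2, this]
    · have : r < t := by linarith
      simp [h1, h2, not_lt.1 h1, not_le.2 h2, this]
    · simp [h1, h2, not_lt.1 h1, not_lt.1 h2]
  simp_rw [key]
  have hf := f_int T δ c hT hcI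
  have he := e_int T δ hT
  rw [MeasureTheory.integral_sub
    (((he.indicator measurableSet_Iic).mul_prod (hf.indicator measurableSet_Ioi)).const_mul _)
    (((he.indicator measurableSet_Ioi).mul_prod (hf.indicator measurableSet_Iic)).const_mul _),
    MeasureTheory.integral_const_mul, MeasureTheory.integral_const_mul,
    integral_prod_mul, integral_prod_mul]
  have hI1 : ∀ g : ℝ → ℝ, ∫ x, (Iic a).indicator g x ∂(nuM T) = ∫ x in (0:ℝ)..a, g x := by
    intro g
    rw [← int_nu T hT, intervalIntegral.integral_of_le hT.le, intervalIntegral.integral_of_le ha0,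
      setIntegral_indicator measurableSet_Iic, Ioc_inter_Iic, min_eq_right haT]
  have hI2 : ∀ g : ℝ → ℝ, ∫ x, (Ioi a).indicator g x ∂(nuM T) = ∫ x in a..T, g x := by
    intro g
    rw [← int_nu T hT, intervalIntegral.integral_of_le hT.le, intervalIntegral.integral_of_le haT,
      setIntegral_indicator measurableSet_Ioi, Ioc_inter_Ioi, max_eq_right ha0]
  rw [hI1, hI1, hI2, hI2, aux_exp_neg δ hδ, aux_exp_neg δ hδ]
  set I1 := ∫ r in (0:ℝ)..a, c r * Real.exp (δ * r)
  set I2 := ∫ r in a..T, c r * Real.exp (δ * r)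
  have hE : 1 < Real.exp ((η + δ) * T) := Real.one_lt_exp_iff.2 (by positivity)
  have hA : (1 - Real.exp (-(η + δ) * T))⁻¹ = Real.exp ((η + δ) * T) * (Real.exp ((η + δ) * T) - 1)⁻¹ := by
    rw [neg_mul, Real.exp_neg]
    have : Real.exp ((η + δ) * T) - 1 ≠ 0 := by linarith
    have h3 : 1 - (Real.exp ((η + δ) * T))⁻¹ = (Real.exp ((η + δ) * T) - 1) * (Real.exp ((η + δ) * T))⁻¹ := by
      field_simp
    rw [h3, mul_inv, inv_inv, mul_comm]
  have hfin : (Real.exp ((η + δ) * T) - 1)⁻¹ * ((Real.exp (-(δ * 0)) - Real.exp (-(δ * a))) / δ * I2) -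
      (1 - Real.exp (-(η + δ) * T))⁻¹ * ((Real.exp (-(δ * a)) - Real.exp (-(δ * T))) / δ * I1) =
      (Real.exp ((η + δ) * T) - 1)⁻¹ * δ⁻¹ * Real.exp (-(δ * a)) * ((Real.exp (δ * a) - 1) * I2 -
        Real.exp (η * T) * ((Real.exp (δ * T) - Real.exp (δ * a)) * I1)) := by
    rw [hA, add_mul η δ T, Real.exp_add, Real.exp_neg, Real.exp_neg, Real.exp_neg]
    generalize (Real.exp (η * T) * Real.exp (δ * T) - 1)⁻¹ = X
    simp only [mul_zero, Real.exp_zero]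
    field_simp
  rw [hfin]
  apply mul_nonneg
  · have : 0 < Real.exp ((η + δ) * T) - 1 := by linarith
    positivity
  · linarith

lemma thr (T : ℝ) (hT : 0 < T) (β : ℝ → ℝ) (hβ : Monotone β) (u : ℝ) :
    ∃ a, 0 ≤ a ∧ a ≤ T ∧ ∀ s ∈ Ioo 0 T, s ≠ a → (u < β s ↔ a < s) := by
  set S : Set ℝ := {0} ∪ {s | s ∈ Ioo 0 T ∧ β s ≤ u}
  have hne : S.Nonempty := ⟨0, Or.inl rfl⟩
  have hub : ∀ s ∈ S, s ≤ T := by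
    rintro s (h | h)
    · rw [mem_singleton_iff] at h; linarith
    · exact h.1.2.le
  have hb : BddAbove S := ⟨T, hub⟩
  refine ⟨sSup S, le_csSup hb (Or.inl rfl), csSup_le hne hub, fun s hs hsa => ⟨fun h => ?_, fun h => ?_⟩⟩
  · by_contra h'
    have hlt : s < sSup S := lt_of_le_of_ne (not_lt.1 h') hsa
    obtain ⟨x, hx, hsx⟩ := exists_lt_of_lt_csSup hne hlt
    rcases hx with hx | hx
    · rw [mem_singleton_iff] at hx; linarith [hs.1]
    · linarith [hβ hsx.le, hx.2]
  · by_contra h'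
    have := le_csSup hb (Or.inr ⟨hs, not_lt.1 h'⟩ : s ∈ S)
    linarith

lemma L_nonneg (T δ η : ℝ) (c β : ℝ → ℝ) (hT : 0 < T) (hδ : 0 < δ) (hη : 0 < η)
    (hcI : IntegrableOn c (Set.Icc 0 T)) (hβ : MemM T η β)
    (hc : ∀ a, 0 ≤ a → a ≤ T → Real.exp (η * T) * ((Real.exp (δ * T) - Real.exp (δ * a)) *
            ∫ r in (0:ℝ)..a, c r * Real.exp (δ * r)) ≤ (Real.exp (δ * a) - 1) *
            (∫ r in a..T, c r * Real.exp (δ * r))) :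
    0 ≤ ∫ p, kk T δ η c p * (β p.2 - β p.1) ∂((nuM T).prod (nuM T)) := by
  have hm := hβ.1.measurable
  have hM : 0 < T * η := by positivity
  set P := (nuM T).prod (nuM T)
  set F : ℝ × ℝ → ℝ → ℝ := fun p u =>
    kk T δ η c p * ((Iio (β p.2)).indicator 1 u - (Iio (β p.1)).indicator 1 u)
  have hlay : ∀ x, 0 ≤ x → x ≤ T * η → ∫ u, (Iio x).indicator (1 : ℝ → ℝ) u ∂(nuM (T * η)) = x := by
    intro x hx hx'
    rw [integral_indicator_one measurableSet_Iio, nuM, measureReal_restrict_apply measurableSet_Iio,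
      inter_comm, Ioo_inter_Iio, min_eq_right hx', Real.volume_real_Ioo_of_le hx, sub_zero]
  have hii : ∀ x : ℝ, Integrable (fun u => (Iio x).indicator (1 : ℝ → ℝ) u) (nuM (T * η)) := by
    intro x
    exact (integrable_const (1:ℝ)).indicator measurableSet_Iio
  have e1 : ∫ p, kk T δ η c p * (β p.2 - β p.1) ∂P = ∫ p, ∫ u, F p u ∂(nuM (T * η)) ∂P := by
    apply MeasureTheory.integral_congr_ae
    filter_upwards [ae_nu T] with p hp
    have bd : ∀ s ∈ Ioo 0 T, 0 ≤ β s ∧ β s ≤ T * η := by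
      intro s hs
      have h1 := hβ.1 hs.2.le
      have h2 := hβ.1 hs.1.le
      rw [hβ.2.2.1] at h2
      rw [hβ.2.2.2.2] at h1
      exact ⟨h2, h1⟩
    simp only [F]
    rw [MeasureTheory.integral_const_mul, MeasureTheory.integral_sub (hii _) (hii _),
      hlay _ (bd _ hp.2).1 (bd _ hp.2).2, hlay _ (bd _ hp.1).1 (bd _ hp.1).2]
  have hFi : Integrable (Function.uncurry F) (P.prod (nuM (T * η))) := by
    have h := (kk_int T δ η c hT hcI).mul_prod (integrable_const (1:ℝ) (μ := nuM (T * η)))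
    have h2 : Integrable (fun z : (ℝ × ℝ) × ℝ => kk T δ η c z.1) (P.prod (nuM (T * η))) := by
      simpa using h
    refine h2.mul_bdd (c := 1) ?_ ?_
    · apply Measurable.aestronglyMeasurable
      have q : ∀ f : (ℝ × ℝ) × ℝ → ℝ, Measurable f →
          Measurable fun z : (ℝ × ℝ) × ℝ => (Iio (f z)).indicator (1 : ℝ → ℝ) z.2 := by
        intro f hf
        simp only [indicator, mem_Iio, Pi.one_apply]
        exact Measurable.ite (measurableSet_lt measurable_snd hf) measurable_const measurable_const
      exact (q _ (hm.comp (measurable_snd.comp measurable_fst))).sub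
        (q _ (hm.comp (measurable_fst.comp measurable_fst)))
    · refine Eventually.of_forall fun z => ?_
      simp only [indicator, Pi.one_apply]
      split_ifs <;> simp
  rw [e1, integral_integral_swap hFi]
  refine integral_nonneg fun u => ?_
  obtain ⟨a, ha0, haT, ha⟩ := thr T hT β hβ.1 u
  have hJ := J_nonneg T δ η c hT hδ hη hcI a ha0 haT (hc a ha0 haT)
  refine hJ.trans_eq ?_
  have hne : ∀ᵐ s ∂(nuM T), s ≠ a := by
    have : ∀ᵐ s ∂(volume : Measure ℝ), s ≠ a := by simp [ae_iff]
    exact ae_restrict_of_ae this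
  apply MeasureTheory.integral_congr_ae
  filter_upwards [ae_nu T, Measure.quasiMeasurePreserving_fst.ae hne,
    Measure.quasiMeasurePreserving_snd.ae hne] with p hp h1 h2
  simp only [F, indicator, mem_Ioi, mem_Iio, Pi.one_apply, ha _ hp.1 h1, ha _ hp.2 h2]

lemma opt (T δ η : ℝ) (c : ℝ → ℝ) (hT : 0 < T) (hδ : 0 < δ) (hη : 0 < η) (hcpos : ∀ t, 0 < c t)
    (hcI : IntegrableOn c (Set.Icc 0 T))
    (hc : ∀ a ∈ Ioo 0 T, Real.exp (η * T) * ((Real.exp (δ * T) - Real.exp (δ * a)) *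
            ∫ r in (0:ℝ)..a, c r * Real.exp (δ * r)) ≤ (Real.exp (δ * a) - 1) *
            (∫ r in a..T, c r * Real.exp (δ * r))) :
    IsOpt T δ η c (fun _ => 1) (fun t => η * T * (⌊t / T⌋ : ℤ)) := by
  have h0 := alpha0_mem T η hT hη
  refine ⟨h0, fun β hβ => ?_⟩
  have hL := L_nonneg T δ η c β hT hδ hη hcI hβ (by
    intro a ha0 haT
    rcases ha0.eq_or_lt with rfl | ha0
    · simp
    rcases haT.eq_or_lt with rfl | haT
    · simp
    exact hc a ⟨ha0, haT⟩)
  have hm := hβ.1.measurable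
  have hki := kk_int T δ η c hT hcI
  have hli : Integrable (fun p : ℝ × ℝ => kk T δ η c p * (β p.2 - β p.1)) ((nuM T).prod (nuM T)) := by
    refine hki.mul_bdd (c := T * η) ?_ ?_
    · exact ((hm.comp measurable_snd).sub (hm.comp measurable_fst)).aestronglyMeasurable
    · filter_upwards [ae_nu T] with p hp
      rw [Real.norm_eq_abs, abs_le]
      have h1 := hβ.1 hp.2.2.le
      have h2 := hβ.1 hp.1.1.le
      have h3 := hβ.1 hp.1.2.le
      have h4 := hβ.1 hp.2.1.le
      rw [hβ.2.2.1] at h2 h4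
      rw [hβ.2.2.2.2] at h1 h3
      constructor <;> linarith
  rw [Phi_eq_s19 T δ η c _ hT hcI h0, Phi_eq_s19 T δ η c β hT hcI hβ]
  have e0 : ∫ p, kk T δ η c p * Real.exp ((fun t => η * T * (⌊t / T⌋ : ℤ)) p.2 -
      (fun t => η * T * (⌊t / T⌋ : ℤ)) p.1) ∂((nuM T).prod (nuM T)) =
      ∫ p, kk T δ η c p ∂((nuM T).prod (nuM T)) := by
    apply MeasureTheory.integral_congr_ae
    filter_upwards [ae_nu T] with p hp
    have : ∀ s ∈ Ioo 0 T, ⌊s / T⌋ = 0 := by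
      intro s hs
      rw [Int.floor_eq_zero_iff]
      exact ⟨div_nonneg hs.1.le hT.le, (div_lt_one hT).2 hs.2⟩
    simp [this _ hp.1, this _ hp.2]
  rw [e0]
  have : ∫ p, (kk T δ η c p + kk T δ η c p * (β p.2 - β p.1)) ∂((nuM T).prod (nuM T)) ≤
      ∫ p, kk T δ η c p * Real.exp (β p.2 - β p.1) ∂((nuM T).prod (nuM T)) := by
    apply integral_mono (hki.add hli) (kkexp_int T δ η c β hT hcI hβ)
    intro p
    have hk : 0 ≤ kk T δ η c p := by
      unfold kk
      exact mul_nonneg (Kker_nonneg T δ η _ _ hT hδ hη)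
        (mul_nonneg (Real.exp_pos _).le (mul_nonneg (hcpos _).le (Real.exp_pos _).le))
    have := mul_le_mul_of_nonneg_left (Real.add_one_le_exp (β p.2 - β p.1)) hk
    simp only [Pi.add_apply]
    linarith
  rw [MeasureTheory.integral_add hki hli] at this
  linarith

lemma unif (T δ : ℝ) (c : ℝ → ℝ) (hT : 0 < T) (hδ : 0 < δ) (hcpos : ∀ t, 0 < c t)
    (hcI : IntegrableOn c (Set.Icc 0 T)) (hmono : StrictMonoOn c (Set.Ioo 0 T)) :
    ∃ ρ > 1, ∀ a ∈ Ioo 0 T, ρ * ((Real.exp (δ * T) - Real.exp (δ * a)) *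
            ∫ r in (0:ℝ)..a, c r * Real.exp (δ * r)) ≤ (Real.exp (δ * a) - 1) *
            (∫ r in a..T, c r * Real.exp (δ * r)) := by
  have hadd : ∀ a b d, 0 ≤ a → a ≤ b → b ≤ d → d ≤ T →
      (∫ r in a..d, c r * Real.exp (δ * r)) = (∫ r in a..b, c r * Real.exp (δ * r)) +
        ∫ r in b..d, c r * Real.exp (δ * r) := by
    intro a b d h1 h2 h3 h4
    exact (intervalIntegral.integral_add_adjacent_intervals
      (aux_ii T δ c hcI a b h1 h2 (by linarith)) (aux_ii T δ c hcI b d (by linarith) h3 h4)).symm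
  have hlt := aux_lt T δ c hδ hcI hmono
  have hpos := aux_pos T δ c hcpos hcI
  have hexp : ∀ a b, a < b → Real.exp (δ * a) < Real.exp (δ * b) := by
    intro a b h
    apply Real.exp_lt_exp.2; nlinarith
  set I : ℝ → ℝ → ℝ := fun a b => ∫ r in a..b, c r * Real.exp (δ * r)
  set m1 : ℝ → ℝ := fun t => I 0 t / (Real.exp (δ * t) - Real.exp (δ * 0))
  set m2 : ℝ → ℝ := fun t => I t T / (Real.exp (δ * T) - Real.exp (δ * t))
  have m1mono : ∀ t s, 0 < t → t < s → s ≤ T → m1 t < m1 s := by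
    intro t s h1 h2 h3
    have := hlt 0 t s le_rfl h1 h2 h3
    have h4 := hadd 0 t s le_rfl h1.le h2.le h3
    have x1 := hexp 0 t h1
    have x2 := hexp t s h2
    simp only [m1]
    rw [div_lt_div_iff₀ (by linarith) (by linarith)]
    simp only [I]
    rw [h4]
    nlinarith
  have m2mono : ∀ t s, 0 ≤ t → t < s → s < T → m2 t < m2 s := by
    intro t s h1 h2 h3
    have := hlt t s T h1 h2 h3 le_rfl
    have h4 := hadd t s T h1 h2.le h3.le le_rfl
    have x1 := hexp t s h2
    have x2 := hexp s T h3
    simp only [m2]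
    rw [div_lt_div_iff₀ (by linarith) (by linarith)]
    simp only [I]
    rw [h4]
    nlinarith
  have hm : m1 T = m2 0 := rfl
  have hm1pos : ∀ t, 0 < t → t ≤ T → 0 < m1 t := fun t h1 h2 =>
    div_pos (hpos 0 t le_rfl h1 h2) (by linarith [hexp 0 t h1])
  have hh : 0 < T / 2 := by positivity
  have hh2 : T / 2 < T := by linarith
  have p1 := hm1pos _ hh hh2.le
  have p2 := hm1pos _ hT le_rfl
  have q1 := m1mono _ _ hh hh2 le_rfl
  have q2 := m2mono _ _ le_rfl hh hh2
  refine ⟨min (m1 T / m1 (T/2)) (m2 (T/2) / m1 T), ?_, ?_⟩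
  · apply lt_min
    · rw [one_lt_div p1]; exact q1
    · rw [one_lt_div p2, hm]; exact q2
  · intro a ha
    have main : min (m1 T / m1 (T/2)) (m2 (T/2) / m1 T) * m1 a ≤ m2 a := by
      have pa := hm1pos a ha.1 ha.2.le
      rcases le_or_gt a (T/2) with h | h
      · have r1 : m1 a ≤ m1 (T/2) := by
          rcases h.eq_or_lt with h | h
          · rw [h]
          · exact (m1mono _ _ ha.1 h hh2.le).le
        calc _ ≤ (m1 T / m1 (T/2)) * m1 (T/2) := by
              apply mul_le_mul (min_le_left _ _) r1 pa.le (by positivity)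
          _ = m1 T := by field_simp
          _ ≤ m2 a := by rw [hm]; exact (m2mono _ _ le_rfl ha.1 ha.2).le
      · have r1 := (m1mono a T ha.1 ha.2 le_rfl).le
        calc _ ≤ (m2 (T/2) / m1 T) * m1 T := by
              apply mul_le_mul (min_le_right _ _) r1 pa.le
              exact div_nonneg (by linarith) p2.le
          _ = m2 (T/2) := by field_simp
          _ ≤ m2 a := (m2mono _ _ hh.le h ha.2).le
    have x1 := hexp 0 a ha.1
    have x2 := hexp a T ha.2
    have y1 : I 0 a = m1 a * (Real.exp (δ * a) - Real.exp (δ * 0)) := by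
      simp only [m1]; rw [div_mul_cancel₀]; linarith
    have y2 : I a T = m2 a * (Real.exp (δ * T) - Real.exp (δ * a)) := by
      simp only [m2]; rw [div_mul_cancel₀]; linarith
    change _ * (_ * I 0 a) ≤ _ * I a T
    rw [y1, y2]
    have := mul_le_mul_of_nonneg_right main (mul_pos (sub_pos.2 x1) (sub_pos.2 x2)).le
    simp only [mul_zero, Real.exp_zero] at this ⊢
    linarith

theorem stmt19 (T δ : ℝ) (c : ℝ → ℝ) (cp cm : ℝ)
    (hT : 0 < T) (hδ : 0 < δ)
    (hcpos : ∀ t, 0 < c t) (hcP : ∀ t, c (t + T) = c t)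
    (hcI : IntegrableOn c (Set.Icc 0 T))
    (hmono : StrictMonoOn c (Set.Ioo 0 T))
    (hcp : Tendsto c (nhdsWithin 0 (Set.Ioi 0)) (𝓝 cp))
    (hcm : Tendsto c (nhdsWithin T (Set.Iio T)) (𝓝 cm))
    (hjump : cp < cm) :
    (∀ t ∈ Set.Ioo (0:ℝ) T,
      0 < (1/T) * Real.log ((Real.exp (δ * t) - 1) *
          (∫ r in t..T, c r * Real.exp (δ * r)) /
        ((Real.exp (δ * T) - Real.exp (δ * t)) *
          ∫ r in (0:ℝ)..t, c r * Real.exp (δ * r)))) ∧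
    (∃ ηb₀ > 0, ∀ ηb : ℝ, 0 < ηb → ηb < ηb₀ →
      IsOpt T δ ηb c (fun _ => 1) (fun t => ηb * T * (⌊t / T⌋ : ℤ))) ∧
    (∀ ηb : ℝ, 0 < ηb →
      (∀ t ∈ Set.Ioo (0:ℝ) T,
        ηb < (1/T) * Real.log ((Real.exp (δ * t) - 1) *
            (∫ r in t..T, c r * Real.exp (δ * r)) /
          ((Real.exp (δ * T) - Real.exp (δ * t)) *
            ∫ r in (0:ℝ)..t, c r * Real.exp (δ * r)))) →
      IsOpt T δ ηb c (fun _ => 1) (fun t => ηb * T * (⌊t / T⌋ : ℤ))) := by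
  have hexp : ∀ a b, a < b → Real.exp (δ * a) < Real.exp (δ * b) := by
    intro a b h
    apply Real.exp_lt_exp.2; nlinarith
  have hden : ∀ t ∈ Set.Ioo (0:ℝ) T, 0 < (Real.exp (δ * T) - Real.exp (δ * t)) *
          ∫ r in (0:ℝ)..t, c r * Real.exp (δ * r) := fun t ht =>
    mul_pos (sub_pos.2 (hexp t T ht.2)) (aux_pos T δ c hcpos hcI 0 t le_rfl ht.1 ht.2.le)
  have hnum : ∀ t ∈ Set.Ioo (0:ℝ) T, 0 < (Real.exp (δ * t) - 1) *
          ∫ r in t..T, c r * Real.exp (δ * r) := fun t ht =>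
    mul_pos (by have := hexp 0 t ht.1; simp only [mul_zero, Real.exp_zero] at this; linarith)
      (aux_pos T δ c hcpos hcI t T ht.1.le ht.2 le_rfl)
  refine ⟨fun t ht => ?_, ?_, ?_⟩
  · apply mul_pos (by positivity)
    apply Real.log_pos
    rw [one_lt_div (hden t ht)]
    have := aux_lt T δ c hδ hcI hmono 0 t T le_rfl ht.1 ht.2 le_rfl
    simp only [mul_zero, Real.exp_zero] at this
    linarith
  · obtain ⟨ρ, hρ, h⟩ := unif T δ c hT hδ hcpos hcI hmono
    refine ⟨Real.log ρ / T, div_pos (Real.log_pos hρ) hT, fun η hη hlt => ?_⟩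
    refine opt T δ η c hT hδ hη hcpos hcI fun a ha => le_trans ?_ (h a ha)
    apply mul_le_mul_of_nonneg_right _ (hden a ha).le
    rw [lt_div_iff₀ hT] at hlt
    rw [← Real.le_log_iff_exp_le (by linarith)]
    exact hlt.le
  · intro η hη h
    refine opt T δ η c hT hδ hη hcpos hcI fun a ha => ?_
    have h1 := h a ha
    rw [one_div, inv_mul_eq_div, lt_div_iff₀ hT] at h1
    rw [← le_div_iff₀ (hden a ha), ← Real.le_log_iff_exp_le (div_pos (hnum a ha) (hden a ha))]
    exact h1.le
end
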